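/- Let V_T : ℝ → ℝ be lower semicontinuous, nondecreasing, bounded from below, and such that liminf_{α→+∞} V_T(α·d)/α > 0 for every d > 0. Define V : ℝ^{T+1} → (−∞,+∞] by V(d) = V_T(d_T) if d_t ≤ 0 for all t = 0,…,T−1, and V(d) = +∞ otherwise. Then: (i) the function g₂(d) := V_T(d_T) on ℝ^{T+1} has horizon function g₂^∞(d) = V_T^∞(d_T) and satisfies condition (w) with base point 0; (ii) V^∞(d) = δ_{ℝ^T_− × ℝ}(d) + V_T^∞(d_T) for every d; (iii) V satisfies condition (w) with base point 0; and (iv) V^∞(d) ≤ 0 if and only if d ∈ ℝ^{T+1}_−. -/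

import Mathlib

open Filter MeasureTheory Metric Set
open scoped Topology ENNReal

attribute [local instance] Classical.propDecidable

noncomputable section

/-- Horizon function: g^∞(w) = lim_{δ↓0} inf{ λ g(w'/λ) : 0<λ<δ, |w'-w| ≤ δ }. -/
def hor {E : Type*} [SeminormedAddCommGroup E] [NormedSpace ℝ E] (g : E → EReal) (w : E) : EReal :=
  ⨆ (δ : ℝ) (_ : 0 < δ), ⨅ (l : ℝ) (_ : l ∈ Set.Ioo (0:ℝ) δ) (w' : E)
      (_ : w' ∈ Metric.closedBall w δ), (l : EReal) * g (l⁻¹ • w')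

/-- The disutility of terminal wealth: V(d) = V_T(d_T) if d_t ≤ 0 for t < T, +∞ otherwise. -/
def termV (T : ℕ) (VT : ℝ → ℝ) (d : Fin (T+1) → ℝ) : EReal :=
  if ∀ t : Fin (T+1), t ≠ Fin.last T → d t ≤ 0 then ((VT (d (Fin.last T)) : ℝ) : EReal) else ⊤

lemma hor_mono {E : Type*} [SeminormedAddCommGroup E] [NormedSpace ℝ E] {g h : E → EReal}
    (hgh : ∀ e, g e ≤ h e) (w : E) : hor g w ≤ hor h w := by
  unfold hor
  refine iSup₂_mono fun δ _ => iInf₂_mono fun l hl => iInf₂_mono fun w' _ => ?_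
  exact mul_le_mul_of_nonneg_left (hgh _) (EReal.coe_nonneg.2 hl.1.le)

/-- The horizon function is dominated by the lower limit along the ray through `w`. -/
lemma hor_le_liminf {E : Type*} [SeminormedAddCommGroup E] [NormedSpace ℝ E]
    (g : E → EReal) (w : E) :
    hor g w ≤ liminf (fun α : ℝ => ((α⁻¹ : ℝ) : EReal) * g (α • w)) atTop := by
  refine iSup₂_le fun δ hδ => le_liminf_of_le (by isBoundedDefault) ?_
  filter_upwards [eventually_gt_atTop δ⁻¹] with α hα
  have hα0 : 0 < α := (inv_pos.2 hδ).trans hα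
  refine iInf₂_le_of_le α⁻¹ ⟨inv_pos.2 hα0, inv_lt_of_inv_lt₀ hδ hα⟩ ?_
  exact iInf₂_le_of_le w (mem_closedBall_self hδ.le) (by rw [inv_inv])

/-- A lower bound holding near `w` for all small scalings bounds the horizon function. -/
lemma le_hor {E : Type*} [SeminormedAddCommGroup E] [NormedSpace ℝ E]
    {g : E → EReal} {w : E} {c : EReal} {δ : ℝ} (hδ : 0 < δ)
    (h : ∀ l ∈ Ioo 0 δ, ∀ w' ∈ closedBall w δ, c ≤ (l : EReal) * g (l⁻¹ • w')) :
    c ≤ hor g w :=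
  le_iSup₂_of_le δ hδ (le_iInf₂ fun l hl => le_iInf₂ fun w' hw' => h l hl w' hw')

lemma hor_nonneg_of_bddBelow {VT : ℝ → ℝ} (hbdd : BddBelow (range VT)) (r : ℝ) :
    0 ≤ hor (fun r : ℝ => ((VT r : ℝ) : EReal)) r := by
  obtain ⟨m, hm⟩ := hbdd
  refine EReal.ge_of_forall_gt_iff_ge.1 fun c hc => ?_
  have hc0 : c < 0 := by exact_mod_cast hc
  have hM : 0 < |m| + 1 := by positivity
  refine le_hor (δ := -c / (|m| + 1)) (div_pos (neg_pos.2 hc0) hM) fun l hl w' _ => ?_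
  rw [← EReal.coe_mul, EReal.coe_le_coe_iff]
  have h1 : m ≤ VT (l⁻¹ • w') := hm ⟨_, rfl⟩
  have h2 := (lt_div_iff₀ hM).1 hl.2
  have h3 := mul_le_mul_of_nonneg_left ((neg_abs_le m).trans h1) hl.1.le
  linarith [hl.1]

lemma liminf_nonpos_of_nonpos {VT : ℝ → ℝ} (hmono : Monotone VT) {r : ℝ} (hr : r ≤ 0) :
    liminf (fun α : ℝ => ((α⁻¹ : ℝ) : EReal) * ((VT (α * r) : ℝ) : EReal)) atTop ≤ 0 := by
  have hlim : Tendsto (fun α : ℝ => ((α⁻¹ * VT 0 : ℝ) : EReal)) atTop (𝓝 0) := by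
    have := (tendsto_inv_atTop_zero (𝕜 := ℝ)).mul_const (VT 0)
    rw [zero_mul] at this
    exact_mod_cast (continuous_coe_real_ereal.tendsto 0).comp this
  refine (liminf_le_liminf ?_).trans_eq hlim.liminf_eq
  filter_upwards [eventually_gt_atTop 0] with α hα
  rw [← EReal.coe_mul, EReal.coe_le_coe_iff]
  exact mul_le_mul_of_nonneg_left (hmono (mul_nonpos_of_nonneg_of_nonpos hα.le hr))
    (inv_nonneg.2 hα.le)

/-- For a monotone function bounded below, the lower limit along a ray is at most the horizon
function. -/
lemma liminf_le_hor {VT : ℝ → ℝ} (hmono : Monotone VT) (hbdd : BddBelow (range VT)) (r : ℝ) :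
    liminf (fun α : ℝ => ((α⁻¹ : ℝ) : EReal) * ((VT (α * r) : ℝ) : EReal)) atTop
      ≤ hor (fun r : ℝ => ((VT r : ℝ) : EReal)) r := by
  have hnonneg := hor_nonneg_of_bddBelow hbdd r
  rcases le_or_gt r 0 with hr | hr
  · exact (liminf_nonpos_of_nonpos hmono hr).trans hnonneg
  refine EReal.ge_of_forall_gt_iff_ge.1 fun c hc => ?_
  rcases le_or_gt c 0 with hc0 | hc0
  · exact le_trans (by exact_mod_cast hc0) hnonneg
  obtain ⟨b, hcb, hb⟩ := EReal.lt_iff_exists_real_btwn.1 hc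
  have hcb : c < b := by exact_mod_cast hcb
  have hb0 : 0 < b := hc0.trans hcb
  have hev := eventually_lt_of_lt_liminf hb
  obtain ⟨A, hA⟩ := eventually_atTop.1 (hev.and (eventually_gt_atTop 0))
  set θ : ℝ := c / b
  have hθ0 : 0 < θ := div_pos hc0 hb0
  have hθ1 : θ < 1 := (div_lt_one hb0).2 hcb
  have hA0 : 0 < A := (hA A le_rfl).2
  refine le_hor (δ := min (r * (1 - θ)) (θ / A))
    (lt_min (mul_pos hr (sub_pos.2 hθ1)) (div_pos hθ0 hA0)) fun l hl w' hw' => ?_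
  have hl0 : 0 < l := hl.1
  have hw : θ * r ≤ w' := by
    have h1 := (abs_le.1 (Real.dist_eq w' r ▸ mem_closedBall.1 hw')).1
    have h2 := min_le_left (r * (1 - θ)) (θ / A)
    linarith
  have hAl : A ≤ l⁻¹ * θ := by
    have h1 := (lt_div_iff₀ hA0).1 (hl.2.trans_le (min_le_right _ _))
    rw [inv_mul_eq_div, le_div_iff₀ hl0]
    linarith
  have h1 := (hA _ hAl).1
  rw [← EReal.coe_mul, EReal.coe_lt_coe_iff, inv_mul_eq_div,
    lt_div_iff₀ (hA _ hAl).2] at h1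
  have h2 : VT (l⁻¹ * θ * r) ≤ VT (l⁻¹ • w') := by
    apply hmono
    rw [smul_eq_mul, mul_assoc]
    exact mul_le_mul_of_nonneg_left hw (inv_nonneg.2 hl0.le)
  rw [← EReal.coe_mul, EReal.coe_le_coe_iff]
  calc c = l * (b * (l⁻¹ * θ)) := by simp only [θ]; field_simp
    _ ≤ l * VT (l⁻¹ • w') := mul_le_mul_of_nonneg_left (h1.le.trans h2) hl0.le

lemma hor_le_hor_comp_last {T : ℕ} (g : ℝ → EReal) (d : Fin (T+1) → ℝ) :
    hor g (d (Fin.last T)) ≤ hor (fun e : Fin (T+1) → ℝ => g (e (Fin.last T))) d := by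
  refine iSup₂_mono fun δ _ => le_iInf₂ fun l hl => le_iInf₂ fun w' hw' => ?_
  refine iInf₂_le_of_le l hl (iInf₂_le_of_le (w' (Fin.last T)) ?_ le_rfl)
  exact mem_closedBall.2 ((dist_le_pi_dist w' d _).trans (mem_closedBall.1 hw'))

lemma hor_termV_eq_top {T : ℕ} (VT : ℝ → ℝ) {d : Fin (T+1) → ℝ} {t : Fin (T+1)}
    (ht : t ≠ Fin.last T) (hd : 0 < d t) : hor (termV T VT) d = ⊤ := by
  refine top_le_iff.1 (le_hor (half_pos hd) fun l hl w' hw' => ?_)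
  have h1 := (dist_le_pi_dist w' d t).trans (mem_closedBall.1 hw')
  rw [Real.dist_eq] at h1
  have h2 : 0 < w' t := by linarith [(abs_le.1 h1).1]
  have h3 : termV T VT (l⁻¹ • w') = ⊤ :=
    if_neg fun h => (h t ht).not_gt (mul_pos (inv_pos.2 hl.1) h2)
  rw [h3, EReal.coe_mul_top_of_pos hl.1]

/-- the horizon function and condition (w) for disutilities of terminal
wealth. -/
theorem terminal_wealth_disutility {T : ℕ} (VT : ℝ → ℝ)
    (hlsc : LowerSemicontinuous VT) (hmono : Monotone VT)
    (hbdd : BddBelow (Set.range VT))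
    (hgrowth : ∀ d : ℝ, 0 < d →
      0 < Filter.liminf (fun α : ℝ => ((α⁻¹ : ℝ) : EReal) * ((VT (α * d) : ℝ) : EReal))
            Filter.atTop) :
    -- (i) the horizon function of g₂(d) := V_T(d_T) and condition (w) for g₂
    (∀ d : Fin (T+1) → ℝ,
      hor (fun e : Fin (T+1) → ℝ => ((VT (e (Fin.last T)) : ℝ) : EReal)) d
        = hor (fun r : ℝ => ((VT r : ℝ) : EReal)) (d (Fin.last T))) ∧
    (∀ d : Fin (T+1) → ℝ,
      hor (fun e : Fin (T+1) → ℝ => ((VT (e (Fin.last T)) : ℝ) : EReal)) d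
        = Filter.liminf
            (fun α : ℝ => ((α⁻¹ : ℝ) : EReal) * ((VT ((α • d) (Fin.last T)) : ℝ) : EReal))
            Filter.atTop) ∧
    -- (ii) the horizon function of V is δ_{ℝ^T_− × ℝ} + V_T^∞(d_T)
    (∀ d : Fin (T+1) → ℝ,
      hor (termV T VT) d
        = (if ∀ t : Fin (T+1), t ≠ Fin.last T → d t ≤ 0 then (0 : EReal) else ⊤)
            + hor (fun r : ℝ => ((VT r : ℝ) : EReal)) (d (Fin.last T))) ∧
    -- (iii) V satisfies condition (w) with base point 0
    (∀ d : Fin (T+1) → ℝ,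
      hor (termV T VT) d
        = Filter.liminf (fun α : ℝ => ((α⁻¹ : ℝ) : EReal) * termV T VT (α • d))
            Filter.atTop) ∧
    -- (iv) V^∞(d) ≤ 0 iff d is in the nonpositive orthant
    (∀ d : Fin (T+1) → ℝ, hor (termV T VT) d ≤ 0 ↔ ∀ t, d t ≤ 0) := by
  set L : ℝ → EReal := fun r =>
    liminf (fun α : ℝ => ((α⁻¹ : ℝ) : EReal) * ((VT (α * r) : ℝ) : EReal)) atTop
  set H : ℝ → EReal := hor (fun r : ℝ => ((VT r : ℝ) : EReal))
  have hHL : ∀ r, H r = L r := fun r =>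
    le_antisymm (hor_le_liminf _ r) (liminf_le_hor hmono hbdd r)
  have hg : ∀ d : Fin (T+1) → ℝ,
      hor (fun e : Fin (T+1) → ℝ => ((VT (e (Fin.last T)) : ℝ) : EReal)) d
        = H (d (Fin.last T)) := fun d =>
    le_antisymm ((hor_le_liminf _ d).trans_eq (hHL _).symm)
      (hor_le_hor_comp_last (fun r => ((VT r : ℝ) : EReal)) d)
  have hV_liminf : ∀ d : Fin (T+1) → ℝ, (∀ t, t ≠ Fin.last T → d t ≤ 0) →
      liminf (fun α : ℝ => ((α⁻¹ : ℝ) : EReal) * termV T VT (α • d)) atTop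
        = L (d (Fin.last T)) := by
    intro d hd
    refine liminf_congr ?_
    filter_upwards [eventually_gt_atTop 0] with α hα
    have : termV T VT (α • d) = ((VT (α * d (Fin.last T)) : ℝ) : EReal) :=
      if_pos fun t ht => mul_nonpos_of_nonneg_of_nonpos hα.le (hd t ht)
    rw [this]
  have hV : ∀ d : Fin (T+1) → ℝ, (∀ t, t ≠ Fin.last T → d t ≤ 0) →
      hor (termV T VT) d = H (d (Fin.last T)) := by
    intro d hd
    refine le_antisymm ?_ ?_
    · rw [hHL, ← hV_liminf d hd]
      exact hor_le_liminf _ d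
    · rw [← hg]
      refine hor_mono (fun e => ?_) d
      unfold termV
      split_ifs
      exacts [le_rfl, le_top]
  have hV_top : ∀ d : Fin (T+1) → ℝ, ¬ (∀ t, t ≠ Fin.last T → d t ≤ 0) →
      hor (termV T VT) d = ⊤ := by
    intro d hd
    push Not at hd
    obtain ⟨t, ht, hdt⟩ := hd
    exact hor_termV_eq_top VT ht hdt
  refine ⟨hg, fun d => (hg d).trans (hHL _), fun d => ?_, fun d => ?_,
    fun d => ⟨fun h => ?_, fun h => ?_⟩⟩
  · by_cases hd : ∀ t, t ≠ Fin.last T → d t ≤ 0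
    · rw [if_pos hd, zero_add, hV d hd]
    · rw [if_neg hd, hV_top d hd, EReal.top_add_of_ne_bot]
      exact (EReal.bot_lt_zero.trans_le (hor_nonneg_of_bddBelow hbdd _)).ne'
  · by_cases hd : ∀ t, t ≠ Fin.last T → d t ≤ 0
    · rw [hV d hd, hV_liminf d hd, hHL]
    · have hle := hor_le_liminf (termV T VT) d
      rw [hV_top d hd] at hle ⊢
      exact (top_le_iff.1 hle).symm
  · have hd : ∀ t, t ≠ Fin.last T → d t ≤ 0 := by
      by_contra hd
      rw [hV_top d hd] at h
      exact h.not_gt EReal.zero_lt_top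
    intro t
    rcases eq_or_ne t (Fin.last T) with rfl | ht
    · rw [hV d hd, hHL] at h
      exact not_lt.1 fun hpos => h.not_gt (hgrowth _ hpos)
    · exact hd t ht
  · rw [hV d fun t _ => h t, hHL]
    exact liminf_nonpos_of_nonpos hmono (h _)

end
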